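/- Brianchon–Gram theorem, outward form: Let P ⊂ ℝⁿ be a full-dimensional polytope, with facet representation P = {y ∈ ℝⁿ : ⟨y, u_F⟩ ≥ a_F for every facet F of P}, where u_F is the unit inward normal of the facet F and a_F ∈ ℝ. For each nonempty face Q of P, let T⁻_{P,Q} = {y ∈ ℝⁿ : ⟨y, u_F⟩ < a_F for every facet F containing Q} be the outward tangent cone at Q (so T⁻_{P,P} = ℝⁿ). Then, as functions on ℝⁿ, 𝟙_P = Σ_{Q ⪯ P} (−1)^{n − dim Q} 𝟙_{T⁻_{P,Q}}, where the sum runs over all nonempty faces Q of P, including P itself. -/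

import Mathlib

open Set MeasureTheory
open scoped RealInnerProductSpace BigOperators Classical Pointwise

noncomputable section

/-- Euclidean space `ℝⁿ` with its standard inner product. -/
abbrev Euc (n : ℕ) := EuclideanSpace ℝ (Fin n)

variable {n : ℕ}
/-- A polytope: the convex hull of a finite set. -/
def IsPolytope (P : Set (Euc n)) : Prop := ∃ S : Finset (Euc n), P = convexHull ℝ ↑S

/-- `Q` is a face of `P`: either `Q = P` or `Q` is the intersection of `P` with a
supporting hyperplane. -/
def IsPolyFace (P Q : Set (Euc n)) : Prop :=
  Q = P ∨ ∃ u : Euc n, u ≠ 0 ∧ ∃ r : ℝ, (∀ y ∈ P, ⟪y, u⟫ ≤ r) ∧ Q = {y ∈ P | ⟪y, u⟫ = r}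

/-- The dimension of a polytope/face: the dimension of the direction of its affine span. -/
def polyDim (Q : Set (Euc n)) : ℕ := Module.finrank ℝ (affineSpan ℝ Q).direction

/-- `F` is a facet of `P`: a face of dimension `n − 1`. -/
def IsFacet (P F : Set (Euc n)) : Prop := IsPolyFace P F ∧ polyDim F + 1 = n

/-- The outward tangent cone `T⁻_{P,Q} = {y : ⟪y, u_F⟫ < a_F for every facet F ⊇ Q}`. -/
def outwardTC (P : Set (Euc n)) (u : Set (Euc n) → Euc n) (a : Set (Euc n) → ℝ)
    (Q : Set (Euc n)) : Set (Euc n) :=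
  {y | ∀ F, IsFacet P F → Q ⊆ F → ⟪y, u F⟫ < a F}


/-- A one-dimensional Euler characteristic: `C` has value `χ` when summing the jumps
`𝟙_C(s) - 𝟙_C(s+)` over all sufficiently large finite sets of points and subtracting the limit of
`𝟙_C` at `-∞` gives `χ`. -/
def HasLineEuler (C : Set ℝ) (χ : ℝ) : Prop :=
  ∃ (S₀ : Finset ℝ) (r : ℝ → ℝ) (b : ℝ),
    (∀ t, Filter.Tendsto (C.indicator fun _ => (1 : ℝ)) (nhdsWithin t (Ioi t)) (nhds (r t))) ∧
    Filter.Tendsto (C.indicator fun _ => (1 : ℝ)) Filter.atBot (nhds b) ∧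
    ∀ S, S₀ ⊆ S → ∑ t ∈ S, (C.indicator (fun _ => (1 : ℝ)) t - r t) - b = χ

lemma hasLineEuler_singleton (p : ℝ) : HasLineEuler {p} 1 := by
  refine ⟨{p}, fun _ => 0, 0, fun t => ?_, ?_, fun S hS => ?_⟩
  · refine tendsto_const_nhds.congr' ?_
    have h : ∀ᶠ y in nhdsWithin t (Ioi t), y ≠ p := by
      rcases lt_or_ge t p with h | h
      · filter_upwards [mem_nhdsWithin_of_mem_nhds (Iio_mem_nhds h)] with y hy using ne_of_lt hy
      · filter_upwards [self_mem_nhdsWithin] with y hy using (h.trans_lt hy).ne'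
    filter_upwards [h] with y hy
    simp [hy]
  · refine tendsto_const_nhds.congr' ?_
    filter_upwards [Filter.eventually_lt_atBot p] with y hy
    simp [hy.ne]
  · rw [Finset.sum_eq_single p]
    · simp
    · intro y _ hy
      simp [hy]
    · intro h
      exact absurd (hS (Finset.mem_singleton_self p)) h

lemma hasLineEuler_open {C : Set ℝ} (hC : Convex ℝ C) (ho : IsOpen C) (hne : C.Nonempty) :
    HasLineEuler C (-1) := by
  have hoc := hC.ordConnected
  obtain ⟨c, hc⟩ := hne
  have hin : ∀ t ∈ C, Filter.Tendsto (C.indicator fun _ => (1 : ℝ)) (nhdsWithin t (Ioi t))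
      (nhds 1) := by
    intro t ht
    refine tendsto_const_nhds.congr' ?_
    filter_upwards [mem_nhdsWithin_of_mem_nhds (ho.mem_nhds ht)] with y hy
    simp [hy]
  by_cases hb : BddBelow C
  · set m := sInf C with hm
    have hglb : IsGLB C m := isGLB_csInf ⟨c, hc⟩ hb
    have hmC : m ∉ C := by
      intro h
      obtain ⟨y, hy, hyC⟩ := ((Filter.Eventually.and
        (self_mem_nhdsWithin : ∀ᶠ y in nhdsWithin m (Iio m), y ∈ Iio m)
        (mem_nhdsWithin_of_mem_nhds (ho.mem_nhds h)))).exists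
      exact absurd (hglb.1 hyC) (not_le.2 hy)
    have hmem : ∀ y, m < y → y ≤ c → y ∈ C := by
      intro y hy hyc
      obtain ⟨z, hz, hzy⟩ := (isGLB_lt_iff hglb).1 hy
      exact hoc.out hz hc ⟨hzy.le, hyc⟩
    have hmc : m < c := lt_of_le_of_ne (hglb.1 hc) (fun h => hmC (h ▸ hc))
    refine ⟨{m}, fun t => if t = m then 1 else C.indicator (fun _ => (1 : ℝ)) t, 0,
      fun t => ?_, ?_, fun S hS => ?_⟩
    · by_cases htm : t = m
      · subst htm
        simp only [if_true]
        refine tendsto_const_nhds.congr' ?_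
        filter_upwards [Ioo_mem_nhdsGT hmc] with y hy
        simp [hmem y hy.1 hy.2.le]
      · by_cases htC : t ∈ C
        · simpa [htm, htC] using hin t htC
        · simp only [if_neg htm, indicator_of_notMem htC]
          refine tendsto_const_nhds.congr' ?_
          rcases lt_or_gt_of_ne htm with h | h
          · filter_upwards [mem_nhdsWithin_of_mem_nhds (Iio_mem_nhds h)] with y hy
            have : y ∉ C := fun hyC => absurd (hglb.1 hyC) (not_le.2 hy)
            simp [this]
          · have hct : c < t := by
              by_contra hle
              exact htC (hmem t h (not_lt.1 hle))
            filter_upwards [self_mem_nhdsWithin] with y hy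
            have : y ∉ C := fun hyC => htC (hoc.out hc hyC ⟨hct.le, le_of_lt hy⟩)
            simp [this]
    · refine tendsto_const_nhds.congr' ?_
      filter_upwards [Filter.eventually_lt_atBot m] with y hy
      have : y ∉ C := fun hyC => absurd (hglb.1 hyC) (not_le.2 hy)
      simp [this]
    · rw [Finset.sum_eq_single m]
      · simp [hmC]
      · intro y _ hy
        simp [hy]
      · intro h
        exact absurd (hS (Finset.mem_singleton_self m)) h
  · have hlow : ∀ y ≤ c, y ∈ C := by
      intro y hy
      obtain ⟨z, hz, hzy⟩ := not_bddBelow_iff.1 hb y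
      exact hoc.out hz hc ⟨hzy.le, hy⟩
    refine ⟨∅, C.indicator fun _ => (1 : ℝ), 1, fun t => ?_, ?_, fun S _ => by simp⟩
    · by_cases htC : t ∈ C
      · simpa [htC] using hin t htC
      · simp only [indicator_of_notMem htC]
        have hct : c < t := by
          by_contra hle
          exact htC (hlow t (not_lt.1 hle))
        refine tendsto_const_nhds.congr' ?_
        filter_upwards [self_mem_nhdsWithin] with y hy
        have : y ∉ C := fun hyC => htC (hoc.out hc hyC ⟨hct.le, le_of_lt hy⟩)
        simp [this]
    · refine tendsto_const_nhds.congr' ?_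
      filter_upwards [Filter.eventually_le_atBot c] with y hy
      simp [hlow y hy]

lemma sum_mul_lineEuler_eq_zero {ι : Type*} (s : Finset ι) (c χ : ι → ℝ) (C : ι → Set ℝ)
    (hC : ∀ i ∈ s, HasLineEuler (C i) (χ i))
    (h0 : ∀ t, ∑ i ∈ s, c i * (C i).indicator (fun _ => (1 : ℝ)) t = 0) :
    ∑ i ∈ s, c i * χ i = 0 := by
  choose! S₀ r b hr hb hS using hC
  have hr0 : ∀ t, ∑ i ∈ s, c i * r i t = 0 := by
    intro t
    have h := tendsto_finsetSum s fun i hi => (hr i hi t).const_mul (c i)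
    simp only [h0] at h
    exact tendsto_nhds_unique h tendsto_const_nhds
  have hb0 : ∑ i ∈ s, c i * b i = 0 := by
    have h := tendsto_finsetSum s fun i hi => (hb i hi).const_mul (c i)
    simp only [h0] at h
    exact tendsto_nhds_unique h tendsto_const_nhds
  have key : ∑ i ∈ s, c i * χ i = ∑ i ∈ s, c i *
      (∑ t ∈ s.biUnion S₀, ((C i).indicator (fun _ => (1 : ℝ)) t - r i t) - b i) :=
    Finset.sum_congr rfl fun i hi => by
      rw [hS i hi _ (Finset.subset_biUnion_of_mem S₀ hi)]
  rw [key]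
  simp only [mul_sub, Finset.sum_sub_distrib, Finset.mul_sum, hb0, sub_zero]
  rw [Finset.sum_comm, Finset.sum_comm (f := fun i t => c i * r i t)]
  simp [h0, hr0]

section RelOpen

variable {E : Type*} [AddCommGroup E] [Module ℝ E]

/-- `C` is a convex set contained in a translate of `W` and (algebraically) open in it. -/
structure IsRelOpenConvex (C : Set E) (W : Submodule ℝ E) : Prop where
  convex : Convex ℝ C
  sub_mem : ∀ y ∈ C, ∀ z ∈ C, z - y ∈ W
  exists_add_smul_mem : ∀ y ∈ C, ∀ w ∈ W, ∃ δ : ℝ, 0 < δ ∧ y + δ • w ∈ C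

namespace IsRelOpenConvex

variable {C : Set E} {W : Submodule ℝ E}

lemma exists_forall_add_smul_mem (h : IsRelOpenConvex C W) {y w : E} (hy : y ∈ C) (hw : w ∈ W) :
    ∃ δ : ℝ, 0 < δ ∧ ∀ τ, 0 ≤ τ → τ ≤ δ → y + τ • w ∈ C := by
  obtain ⟨δ, hδ, hm⟩ := h.exists_add_smul_mem y hy w hw
  refine ⟨δ, hδ, fun τ h0 h1 => ?_⟩
  have := h.convex.add_smul_mem hy hm (t := τ / δ) ⟨by positivity, (div_le_one hδ).2 h1⟩
  rwa [smul_smul, div_mul_cancel₀ _ hδ.ne'] at this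

lemma slice (h : IsRelOpenConvex C W) (f : E →ₗ[ℝ] ℝ) (t : ℝ) :
    IsRelOpenConvex (C ∩ {y | f y = t}) (W ⊓ LinearMap.ker f) where
  convex := h.convex.inter (convex_hyperplane f.isLinear t)
  sub_mem := fun y hy z hz => ⟨h.sub_mem y hy.1 z hz.1, by
    have h1 : f y = t := hy.2
    have h2 : f z = t := hz.2
    simp [h1, h2]⟩
  exists_add_smul_mem := fun y hy w hw => by
    obtain ⟨δ, hδ, hm⟩ := h.exists_add_smul_mem y hy.1 w hw.1
    refine ⟨δ, hδ, hm, ?_⟩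
    have h1 : f y = t := hy.2
    have h2 : f w = 0 := hw.2
    simp [h1, h2]

lemma isOpen_image (h : IsRelOpenConvex C W) (f : E →ₗ[ℝ] ℝ) (hf : ¬ W ≤ LinearMap.ker f) :
    IsOpen (f '' C) := by
  obtain ⟨v, hv, hfv⟩ := SetLike.not_le_iff_exists.1 hf
  have hfv : f v ≠ 0 := hfv
  set w := (f v)⁻¹ • v with hw
  have hwW : w ∈ W := W.smul_mem _ hv
  have hfw : f w = 1 := by simp [hw, hfv]
  rw [isOpen_iff_mem_nhds]
  rintro _ ⟨y, hy, rfl⟩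
  obtain ⟨δ, hδ, h1⟩ := h.exists_add_smul_mem y hy w hwW
  obtain ⟨η, hη, h2⟩ := h.exists_add_smul_mem y hy (-w) (W.neg_mem hwW)
  have hoc := (h.convex.is_linear_image f.isLinear).ordConnected
  refine Filter.mem_of_superset (Icc_mem_nhds (a := f y - η) (b := f y + δ) ?_ ?_)
    (hoc.out ⟨_, h2, ?_⟩ ⟨_, h1, ?_⟩)
  · linarith
  · linarith
  · simp [hfw, sub_eq_add_neg]
  · simp [hfw]

end IsRelOpenConvex

lemma finrank_inf_ker_add_one [FiniteDimensional ℝ E] (W : Submodule ℝ E) (f : E →ₗ[ℝ] ℝ)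
    (hf : ¬ W ≤ LinearMap.ker f) :
    Module.finrank ℝ (W ⊓ LinearMap.ker f : Submodule ℝ E) + 1 = Module.finrank ℝ W := by
  have hne : f.domRestrict W ≠ 0 := by
    intro h
    exact hf fun w hw => by simpa using LinearMap.congr_fun h ⟨w, hw⟩
  have h1 := Module.Dual.finrank_ker_add_one_of_ne_zero (f := f.domRestrict W) hne
  rw [← h1]
  have h2 : LinearMap.ker (f.domRestrict W) = (LinearMap.ker f).comap W.subtype := by
    ext; simp
  rw [h2]
  have h3 := (Submodule.equivSubtypeMap W ((LinearMap.ker f).comap W.subtype)).finrank_eq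
  rw [Submodule.map_comap_subtype] at h3
  rw [h3]

/-- The Euler relation: a linear relation among indicators of relatively open convex sets
persists when each indicator is replaced by `(-1) ^ dim`. -/
theorem sum_mul_neg_one_pow_eq_zero [FiniteDimensional ℝ E] {ι : Type*} (k : ℕ) :
    ∀ (B : Submodule ℝ E) (o : E) (s : Finset ι) (c : ι → ℝ) (C : ι → Set E)
      (W : ι → Submodule ℝ E), Module.finrank ℝ B ≤ k →
      (∀ i ∈ s, IsRelOpenConvex (C i) (W i)) → (∀ i ∈ s, (C i).Nonempty) →
      (∀ i ∈ s, ∀ y ∈ C i, y - o ∈ B) →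
      (∀ y, ∑ i ∈ s, c i * (C i).indicator (fun _ => (1 : ℝ)) y = 0) →
      ∑ i ∈ s, c i * (-1 : ℝ) ^ Module.finrank ℝ (W i) = 0 := by
  induction k with
  | zero =>
    intro B o s c C W hB hC hne hBo h0
    have hB0 : B = ⊥ := Submodule.finrank_eq_zero.1 (Nat.le_zero.1 hB)
    subst hB0
    have hpt : ∀ i ∈ s, ∀ y ∈ C i, y = o := fun i hi y hy =>
      sub_eq_zero.1 ((Submodule.mem_bot ℝ).1 (hBo i hi y hy))
    refine Eq.trans ?_ (h0 o)
    refine Finset.sum_congr rfl fun i hi => ?_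
    obtain ⟨y, hy⟩ := hne i hi
    have hyo := hpt i hi y hy
    subst hyo
    have hW : W i = ⊥ := by
      rw [eq_bot_iff]
      intro w hw
      obtain ⟨δ, hδ, hm⟩ := (hC i hi).exists_add_smul_mem _ hy w hw
      have := hpt i hi _ hm
      simpa [hδ.ne'] using this
    rw [hW]
    simp [hy]
  | succ k ih =>
    intro B o s c C W hB hC hne hBo h0
    by_cases hB0 : B = ⊥
    · exact ih B o s c C W (by rw [hB0]; simp) hC hne hBo h0
    obtain ⟨v, hv, hv0⟩ := B.ne_bot_iff.1 hB0
    obtain ⟨f, hfv⟩ := Module.Projective.exists_dual_eq_one ℝ hv0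
    set σ : ι → ℝ := fun i => if W i ≤ LinearMap.ker f then 1 else -1 with hσ
    have hline : ∀ i ∈ s, HasLineEuler (f '' C i) (σ i) := by
      intro i hi
      obtain ⟨y, hy⟩ := hne i hi
      by_cases hW : W i ≤ LinearMap.ker f
      · have : f '' C i = {f y} := by
          refine Subset.antisymm ?_ (by simpa using ⟨y, hy, rfl⟩)
          rintro _ ⟨z, hz, rfl⟩
          have := hW ((hC i hi).sub_mem y hy z hz)
          simpa [sub_eq_zero] using this
        rw [this]
        simpa [hσ, hW] using hasLineEuler_singleton (f y)
      · have := hasLineEuler_open ((hC i hi).convex.is_linear_image f.isLinear)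
          ((hC i hi).isOpen_image f hW) ⟨_, y, hy, rfl⟩
        simpa [hσ, hW] using this
    have hdim : ∀ i, (-1 : ℝ) ^ Module.finrank ℝ (W i ⊓ LinearMap.ker f : Submodule ℝ E) =
        σ i * (-1 : ℝ) ^ Module.finrank ℝ (W i) := by
      intro i
      by_cases hW : W i ≤ LinearMap.ker f
      · rw [inf_eq_left.2 hW]
        simp [hσ, hW]
      · rw [← finrank_inf_ker_add_one (W i) f hW]
        simp [hσ, hW, pow_succ]
    have hslice : ∀ t, ∑ i ∈ s, (c i * (σ i * (-1 : ℝ) ^ Module.finrank ℝ (W i))) *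
        (f '' C i).indicator (fun _ => (1 : ℝ)) t = 0 := by
      intro t
      have key := ih (B ⊓ LinearMap.ker f) (o + (t - f o) • v)
        (s.filter fun i => (C i ∩ {y | f y = t}).Nonempty) c (fun i => C i ∩ {y | f y = t})
        (fun i => W i ⊓ LinearMap.ker f) ?_ ?_ ?_ ?_ ?_
      · rw [← key, Finset.sum_filter]
        refine Finset.sum_congr rfl fun i _ => ?_
        have hiff : t ∈ f '' C i ↔ (C i ∩ {y | f y = t}).Nonempty := Iff.rfl
        by_cases ht : t ∈ f '' C i
        · rw [if_pos (hiff.1 ht), indicator_of_mem ht, hdim, mul_one]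
        · rw [if_neg (fun h => ht (hiff.2 h)), indicator_of_notMem ht, mul_zero]
      · have hBf : ¬ B ≤ LinearMap.ker f := fun h => by
          have : f v = 0 := h hv
          simp [hfv] at this
        have := finrank_inf_ker_add_one B f hBf
        omega
      · exact fun i hi => (hC i (Finset.mem_filter.1 hi).1).slice f t
      · exact fun i hi => (Finset.mem_filter.1 hi).2
      · rintro i hi y ⟨hy, hyt⟩
        have hyt : f y = t := hyt
        refine ⟨?_, by simp [hyt, hfv]⟩
        rw [← sub_sub]
        exact B.sub_mem (hBo i (Finset.mem_filter.1 hi).1 y hy) (B.smul_mem _ hv)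
      · intro y
        rw [Finset.sum_filter]
        by_cases hyt : f y = t
        · refine Eq.trans ?_ (h0 y)
          refine Finset.sum_congr rfl fun i _ => ?_
          by_cases hy : y ∈ C i
          · have hm : y ∈ C i ∩ {y | f y = t} := ⟨hy, hyt⟩
            rw [if_pos ⟨y, hm⟩, indicator_of_mem hm, indicator_of_mem hy]
          · have hm : y ∉ C i ∩ {y | f y = t} := fun h => hy h.1
            rw [indicator_of_notMem hm, indicator_of_notMem hy, mul_zero, ite_self]
        · refine Finset.sum_eq_zero fun i _ => ?_
          have hm : y ∉ C i ∩ {y | f y = t} := fun h => hyt h.2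
          simp [indicator_of_notMem hm]
    have := sum_mul_lineEuler_eq_zero s _ σ _ hline hslice
    rw [← this]
    refine Finset.sum_congr rfl fun i _ => ?_
    have hσ2 : σ i * σ i = 1 := by
      by_cases hW : W i ≤ LinearMap.ker f <;> simp [hσ, hW]
    linear_combination (-(c i) * (-1 : ℝ) ^ Module.finrank ℝ (W i)) * hσ2

/-- The open cone with apex `x` over the set `R`. -/
def apexCone (x : E) (R : Set E) : Set E :=
  {z | ∃ s : ℝ, 0 < s ∧ ∃ w ∈ R, z = x + s • (w - x)}

lemma IsRelOpenConvex.apexCone {R : Set E} {D : Submodule ℝ E} (h : IsRelOpenConvex R D)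
    (x : E) {w₀ : E} (hw₀ : w₀ ∈ R) :
    IsRelOpenConvex (apexCone x R) (D ⊔ Submodule.span ℝ {w₀ - x}) where
  convex := by
    rintro _ ⟨s, hs, w, hw, rfl⟩ _ ⟨s', hs', w', hw', rfl⟩ α β hα hβ hαβ
    have hpos : 0 < α * s + β * s' := by
      rcases hα.lt_or_eq with h | h
      · positivity
      · obtain rfl : β = 1 := by linarith
        rw [← h]; simpa using hs'
    refine ⟨α * s + β * s', hpos, _, h.convex hw hw' (a := α * s / (α * s + β * s'))
      (b := β * s' / (α * s + β * s')) (by positivity) (by positivity) (by field_simp), ?_⟩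
    rw [smul_sub (α * s + β * s'), smul_add (α * s + β * s'), smul_smul (α * s + β * s'),
      smul_smul (α * s + β * s'), mul_div_cancel₀ _ hpos.ne', mul_div_cancel₀ _ hpos.ne']
    obtain rfl : β = 1 - α := by linarith
    module
  sub_mem := by
    rintro _ ⟨s, hs, w, hw, rfl⟩ _ ⟨s', hs', w', hw', rfl⟩
    have e : x + s' • (w' - x) - (x + s • (w - x)) =
        (s' • (w' - w₀) - s • (w - w₀)) + (s' - s) • (w₀ - x) := by module
    rw [e]
    exact Submodule.add_mem_sup
      (D.sub_mem (D.smul_mem _ (h.sub_mem _ hw₀ _ hw')) (D.smul_mem _ (h.sub_mem _ hw₀ _ hw)))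
      (Submodule.smul_mem _ _ (Submodule.mem_span_singleton_self _))
  exists_add_smul_mem := by
    rintro _ ⟨s, hs, w, hw, rfl⟩ d hd
    obtain ⟨v, hv, e, he, rfl⟩ := Submodule.mem_sup.1 hd
    obtain ⟨c, rfl⟩ := Submodule.mem_span_singleton.1 he
    have hv' : v + c • (w₀ - w) ∈ D := D.add_mem hv (D.smul_mem _ (h.sub_mem _ hw _ hw₀))
    obtain ⟨η, hη, hR⟩ := h.exists_forall_add_smul_mem hw hv'
    have hs' : ∀ᶠ δ in nhdsWithin (0 : ℝ) (Ioi 0), s / 2 < s + δ * c := by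
      refine nhdsWithin_le_nhds ?_
      have : ContinuousAt (fun δ : ℝ => s + δ * c) 0 := by fun_prop
      exact this.eventually (lt_mem_nhds (by simpa using hs))
    have hδη : ∀ᶠ δ in nhdsWithin (0 : ℝ) (Ioi 0), δ < η * (s / 2) :=
      nhdsWithin_le_nhds (gt_mem_nhds (by positivity))
    obtain ⟨δ, ⟨h1, h2⟩, h3⟩ := ((hs'.and hδη).and self_mem_nhdsWithin).exists
    have h3 : 0 < δ := h3
    have hpos : 0 < s + δ * c := by linarith [half_pos hs]
    refine ⟨δ, h3, s + δ * c, hpos, _, hR (δ / (s + δ * c)) (by positivity) ?_, ?_⟩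
    · rw [div_le_iff₀ hpos]
      nlinarith
    · have : (s + δ * c) • (δ / (s + δ * c)) • (v + c • (w₀ - w)) = δ • (v + c • (w₀ - w)) := by
        rw [smul_smul, mul_div_cancel₀ _ hpos.ne']
      rw [add_sub_right_comm, smul_add (s + δ * c), this]
      module

end RelOpen

section Arrangement

variable {E ι : Type*} [AddCommGroup E] [Module ℝ E]

/-- The points where exactly the constraints in `T`, among the constraints `a i ≤ f i y` for
`i ∈ I`, are tight. -/
def tightStratum (I : Finset ι) (f : ι → E →ₗ[ℝ] ℝ) (a : ι → ℝ) (T : Finset ι) : Set E :=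
  {y | (∀ i ∈ T, f i y = a i) ∧ ∀ i ∈ I, i ∉ T → a i < f i y}

/-- The common kernel of the functionals `f i`, `i ∈ T`. -/
def commonKer (f : ι → E →ₗ[ℝ] ℝ) (T : Finset ι) : Submodule ℝ E :=
  ⨅ i ∈ T, LinearMap.ker (f i)

lemma mem_commonKer {f : ι → E →ₗ[ℝ] ℝ} {T : Finset ι} {v : E} :
    v ∈ commonKer f T ↔ ∀ i ∈ T, f i v = 0 := by
  simp [commonKer]

variable {I : Finset ι} {f : ι → E →ₗ[ℝ] ℝ} {a : ι → ℝ} {T T' : Finset ι}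

lemma tightStratum_inj (hT : T ⊆ I) (hT' : T' ⊆ I) {y : E} (h : y ∈ tightStratum I f a T)
    (h' : y ∈ tightStratum I f a T') : T = T' := by
  ext i
  constructor
  · intro hi
    by_contra hn
    exact (h'.2 i (hT hi) hn).ne' (h.1 i hi)
  · intro hi
    by_contra hn
    exact (h.2 i (hT' hi) hn).ne' (h'.1 i hi)

lemma exists_pos_forall_lt_add_mul (J : Finset ι) (p q b : ι → ℝ)
    (h : ∀ i ∈ J, b i < p i ∨ (b i = p i ∧ 0 < q i)) :
    ∃ δ : ℝ, 0 < δ ∧ ∀ i ∈ J, b i < p i + δ * q i := by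
  have hev : ∀ᶠ δ in nhdsWithin (0 : ℝ) (Ioi 0), ∀ i ∈ J, b i < p i + δ * q i := by
    rw [Filter.eventually_all_finset]
    intro i hi
    rcases h i hi with hlt | ⟨heq, hq⟩
    · refine nhdsWithin_le_nhds ?_
      have : ContinuousAt (fun δ : ℝ => p i + δ * q i) 0 := by fun_prop
      exact this.eventually (lt_mem_nhds (by simpa using hlt))
    · filter_upwards [self_mem_nhdsWithin] with δ hδ
      rw [heq]
      have : 0 < δ * q i := mul_pos hδ hq
      linarith
  obtain ⟨δ, h1, h2⟩ := (hev.and self_mem_nhdsWithin).exists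
  exact ⟨δ, h2, h1⟩

lemma isRelOpenConvex_tightStratum :
    IsRelOpenConvex (tightStratum I f a T) (commonKer f T) where
  convex := by
    intro y hy z hz α β hα hβ hαβ
    refine ⟨fun i hi => ?_, fun i hi hiT => ?_⟩
    · simp only [map_add, map_smul, hy.1 i hi, hz.1 i hi, smul_eq_mul]
      rw [← add_mul, hαβ, one_mul]
    · have := convex_halfSpace_gt (f i).isLinear (a i) (hy.2 i hi hiT) (hz.2 i hi hiT) hα hβ hαβ
      exact this
  sub_mem := fun y hy z hz => mem_commonKer.2 fun i hi => by
    rw [map_sub, hy.1 i hi, hz.1 i hi, sub_self]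
  exists_add_smul_mem := by
    intro y hy w hw
    obtain ⟨δ, hδ, h⟩ := exists_pos_forall_lt_add_mul (I \ T) (fun i => f i y) (fun i => f i w) a
      fun i hi => Or.inl (hy.2 i (Finset.mem_sdiff.1 hi).1 (Finset.mem_sdiff.1 hi).2)
    refine ⟨δ, hδ, fun i hi => ?_, fun i hi hiT => ?_⟩
    · simp [mem_commonKer.1 hw i hi, hy.1 i hi]
    · simpa using h i (Finset.mem_sdiff.2 ⟨hi, hiT⟩)

lemma apexCone_tightStratum_subset {x : E} (hx : ∀ i ∈ T, f i x < a i) :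
    apexCone x (tightStratum I f a T) ⊆ apexCone x (tightStratum I f a ∅) := by
  rintro _ ⟨s, hs, w, hw, rfl⟩
  obtain ⟨δ, hδ, h⟩ := exists_pos_forall_lt_add_mul I (fun i => f i w) (fun i => f i (w - x)) a
    fun i hi => by
      by_cases hiT : i ∈ T
      · exact Or.inr ⟨(hw.1 i hiT).symm, by rw [map_sub, hw.1 i hiT]; linarith [hx i hiT]⟩
      · exact Or.inl (hw.2 i hi hiT)
  refine ⟨s / (1 + δ), by positivity, w + δ • (w - x), ⟨by simp, fun i hi _ => ?_⟩, ?_⟩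
  · simpa using h i hi
  · have e : w + δ • (w - x) - x = (1 + δ) • (w - x) := by module
    rw [e, smul_smul, div_mul_cancel₀ _ (by positivity)]

lemma le_of_smul_sub_eq_smul_sub (hT' : T' ⊆ I) (hne' : T'.Nonempty) {x w w' : E}
    (hx' : ∀ i ∈ T', f i x < a i) (hw : w ∈ tightStratum I f a T)
    (hw' : w' ∈ tightStratum I f a T') {s s' : ℝ} (hs' : 0 < s')
    (he : s • (w - x) = s' • (w' - x)) : s ≤ s' := by
  by_contra! hlt
  obtain ⟨i, hi⟩ := hne'
  have h1 : a i ≤ f i w := by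
    by_cases hiT : i ∈ T
    · exact (hw.1 i hiT).ge
    · exact (hw.2 i (hT' hi) hiT).le
  have h2 := congrArg (f i) he
  simp only [map_smul, map_sub, smul_eq_mul, hw'.1 i hi] at h2
  nlinarith [hx' i hi, mul_pos (sub_pos.2 hlt) (sub_pos.2 (hx' i hi)),
    mul_nonneg (hs'.trans hlt).le (sub_nonneg.2 h1)]

lemma eq_of_mem_apexCone (hT : T ⊆ I) (hT' : T' ⊆ I) (hne : T.Nonempty) (hne' : T'.Nonempty)
    {x z : E} (hx : ∀ i ∈ T, f i x < a i) (hx' : ∀ i ∈ T', f i x < a i)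
    (hz : z ∈ apexCone x (tightStratum I f a T)) (hz' : z ∈ apexCone x (tightStratum I f a T')) :
    T = T' := by
  obtain ⟨s, hs, w, hw, rfl⟩ := hz
  obtain ⟨s', hs', w', hw', he⟩ := hz'
  have he : s • (w - x) = s' • (w' - x) := add_left_cancel he
  obtain rfl : s = s' := le_antisymm (le_of_smul_sub_eq_smul_sub hT' hne' hx' hw hw' hs' he)
    (le_of_smul_sub_eq_smul_sub hT hne hx hw' hw hs he.symm)
  obtain rfl : w = w' := sub_left_injective (smul_right_injective E hs.ne' he)
  exact tightStratum_inj hT hT' hw hw'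

lemma exists_mem_apexCone_tightStratum {x z : E} (hvis : ∃ i ∈ I, f i x < a i)
    (hz : z ∈ apexCone x (tightStratum I f a ∅)) :
    ∃ T ⊆ I, T.Nonempty ∧ (∀ i ∈ T, f i x < a i) ∧
      z ∈ apexCone x (tightStratum I f a T) := by
  obtain ⟨s, hs, w, hw, rfl⟩ := hz
  have hw : ∀ i ∈ I, a i < f i w := fun i hi => hw.2 i hi (by simp)
  obtain ⟨j, hj, hmax⟩ := Finset.exists_max_image (I.filter fun i => f i x < a i)
    (fun i => (a i - f i x) / (f i w - f i x))
    (by obtain ⟨i, hi, h⟩ := hvis; exact ⟨i, Finset.mem_filter.2 ⟨hi, h⟩⟩)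
  obtain ⟨hjI, hjx⟩ := Finset.mem_filter.1 hj
  set τ := (a j - f j x) / (f j w - f j x) with hτ
  have hτpos : 0 < τ := div_pos (by linarith) (by linarith [hw j hjI])
  set p := x + τ • (w - x) with hp
  have hfp : ∀ i, f i p = f i x + τ * (f i w - f i x) := fun i => by simp [hp]
  have hinv : ∀ i ∈ I, a i ≤ f i x → a i < f i p := by
    intro i hi hix
    rw [hfp]
    rcases hix.lt_or_eq with h | h
    · have hτ1 : τ < 1 := (div_lt_one (by linarith [hw j hjI])).2 (by linarith [hw j hjI])
      nlinarith [hw i hi]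
    · nlinarith [hw i hi, mul_pos hτpos (sub_pos.2 (hw i hi))]
  have hge : ∀ i ∈ I, a i ≤ f i p := by
    intro i hi
    by_cases hix : f i x < a i
    · have := hmax i (Finset.mem_filter.2 ⟨hi, hix⟩)
      rw [div_le_iff₀ (by linarith [hw i hi])] at this
      rw [hfp]
      linarith
    · exact (hinv i hi (not_lt.1 hix)).le
  refine ⟨I.filter fun i => f i p = a i, Finset.filter_subset _ _,
    ⟨j, Finset.mem_filter.2 ⟨hjI, ?_⟩⟩, fun i hi => ?_, s / τ, by positivity, p,
    ⟨fun i hi => (Finset.mem_filter.1 hi).2, fun i hi hiT => ?_⟩, ?_⟩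
  · rw [hfp, hτ, div_mul_cancel₀ _ (by linarith [hw j hjI])]
    ring
  · obtain ⟨hiI, hip⟩ := Finset.mem_filter.1 hi
    by_contra! h
    exact (hinv i hiI h).ne' hip
  · exact lt_of_le_of_ne (hge i hi) fun h => hiT (Finset.mem_filter.2 ⟨hi, h.symm⟩)
  · rw [hp, add_sub_cancel_left, smul_smul, div_mul_cancel₀ _ hτpos.ne']

lemma finrank_sup_span_singleton_of_notMem [FiniteDimensional ℝ E] {W : Submodule ℝ E} {v : E}
    (hv : v ∉ W) :
    Module.finrank ℝ (W ⊔ Submodule.span ℝ {v} : Submodule ℝ E) = Module.finrank ℝ W + 1 := by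
  have hv0 : v ≠ 0 := fun h => hv (h ▸ W.zero_mem)
  have hd : Disjoint W (Submodule.span ℝ {v}) := (Submodule.disjoint_span_singleton' hv0).2 hv
  have := Submodule.finrank_sup_add_finrank_inf_eq W (Submodule.span ℝ {v})
  rwa [hd.eq_bot, finrank_bot, add_zero, finrank_span_singleton hv0] at this

/-- The alternating sum over the nonempty strata all of whose tight constraints are violated
at `x`. -/
theorem sum_visible_strata [FiniteDimensional ℝ E] (hint : (tightStratum I f a ∅).Nonempty)
    (x : E) :
    ∑ T ∈ I.powerset.filter (fun T => (tightStratum I f a T).Nonempty ∧ ∀ i ∈ T, f i x < a i),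
        (-1 : ℝ) ^ Module.finrank ℝ (commonKer f T) =
      if ∃ i ∈ I, f i x < a i then 0 else (-1) ^ Module.finrank ℝ E := by
  set 𝒱 := I.powerset.filter
    (fun T => (tightStratum I f a T).Nonempty ∧ ∀ i ∈ T, f i x < a i) with h𝒱
  have hmem : ∀ T, T ∈ 𝒱 ↔ T ⊆ I ∧ (tightStratum I f a T).Nonempty ∧ ∀ i ∈ T, f i x < a i :=
    fun T => by simp [h𝒱]
  have hempty : ∅ ∈ 𝒱 := (hmem _).2 ⟨by simp, hint, by simp⟩
  have hker : commonKer f ∅ = ⊤ := by simp [commonKer]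
  split_ifs with hvis
  swap
  · rw [Finset.sum_eq_single ∅, hker, finrank_top]
    · intro T hT hT0
      obtain ⟨i, hi⟩ := Finset.nonempty_iff_ne_empty.2 hT0
      exact absurd ⟨i, ((hmem T).1 hT).1 hi, ((hmem T).1 hT).2.2 i hi⟩ hvis
    · exact fun h => absurd hempty h
  choose! w hw using fun T hT => ((hmem T).1 hT).2.1
  set W : Finset ι → Submodule ℝ E := fun T => commonKer f T ⊔ Submodule.span ℝ {w T - x}
  have hopen : ∀ T ∈ 𝒱, IsRelOpenConvex (apexCone x (tightStratum I f a T)) (W T) :=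
    fun T hT => isRelOpenConvex_tightStratum.apexCone x (hw T hT)
  have hne : ∀ T ∈ 𝒱, (apexCone x (tightStratum I f a T)).Nonempty :=
    fun T hT => ⟨_, 1, one_pos, w T, hw T hT, rfl⟩
  have key := sum_mul_neg_one_pow_eq_zero (Module.finrank ℝ E) ⊤ 0 𝒱
    (fun T => if T = ∅ then 1 else -1) (fun T => apexCone x (tightStratum I f a T)) W
    (Submodule.finrank_le _) hopen hne (fun _ _ _ _ => trivial) ?_
  · refine Eq.trans (Finset.sum_congr rfl fun T hT => ?_) key
    by_cases hT0 : T = ∅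
    · subst hT0
      have hW : W ∅ = ⊤ := by simp [W, hker]
      rw [hW, hker, if_pos rfl, one_mul]
    · obtain ⟨i, hi⟩ := Finset.nonempty_iff_ne_empty.2 hT0
      have hnot : w T - x ∉ commonKer f T := by
        intro h
        have h1 := mem_commonKer.1 h i hi
        rw [map_sub, (hw T hT).1 i hi] at h1
        linarith [((hmem T).1 hT).2.2 i hi]
      rw [if_neg hT0, finrank_sup_span_singleton_of_notMem hnot, pow_succ]
      ring
  · intro z
    rw [← Finset.add_sum_erase _ _ hempty]
    have hnonempty : ∀ T ∈ 𝒱.erase ∅, T.Nonempty := fun T hT =>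
      Finset.nonempty_iff_ne_empty.2 (Finset.mem_erase.1 hT).1
    by_cases hz : z ∈ apexCone x (tightStratum I f a ∅)
    · obtain ⟨T, hTI, hT0, hTx, hzT⟩ := exists_mem_apexCone_tightStratum hvis hz
      have hTne : (tightStratum I f a T).Nonempty := by
        obtain ⟨_, _, p, hp, _⟩ := hzT
        exact ⟨p, hp⟩
      have hT𝒱 : T ∈ 𝒱.erase ∅ :=
        Finset.mem_erase.2 ⟨hT0.ne_empty, (hmem T).2 ⟨hTI, hTne, hTx⟩⟩
      rw [Finset.sum_eq_single T]
      · simp [hz, hzT, hT0.ne_empty]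
      · intro T' hT' hTT'
        have hT'𝒱 := (hmem T').1 (Finset.mem_erase.1 hT').2
        rw [indicator_of_notMem, mul_zero]
        exact fun hz' => hTT'
          (eq_of_mem_apexCone hT'𝒱.1 hTI (hnonempty T' hT') hT0 hT'𝒱.2.2 hTx hz' hzT)
      · exact fun h => absurd hT𝒱 h
    · rw [indicator_of_notMem hz, mul_zero, zero_add]
      refine Finset.sum_eq_zero fun T hT => ?_
      have hT𝒱 := (hmem T).1 (Finset.mem_erase.1 hT).2
      rw [indicator_of_notMem, mul_zero]
      exact fun h => hz (apexCone_tightStratum_subset hT𝒱.2.2 h)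

end Arrangement

lemma not_subset_hyperplane {P : Set (Euc n)} (hfull : affineSpan ℝ P = ⊤) {v : Euc n}
    (hv : v ≠ 0) (r : ℝ) : ¬ ∀ y ∈ P, ⟪y, v⟫ = r := by
  intro h
  have h1 : vectorSpan ℝ P ≤ LinearMap.ker (innerₛₗ ℝ v) := by
    rw [vectorSpan_def, Submodule.span_le]
    rintro _ ⟨y, hy, z, hz, rfl⟩
    simp [← real_inner_comm v, inner_sub_left, h y hy, h z hz]
  rw [← direction_affineSpan, hfull, AffineSubspace.direction_top] at h1
  have h2 : ⟪v, v⟫ = (0 : ℝ) := h1 (Submodule.mem_top (x := v))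
  exact hv (inner_self_eq_zero.1 h2)

lemma exists_mem_forall_lt {E ι : Type*} [AddCommGroup E] [Module ℝ E] {Q : Set E}
    (hQ : Convex ℝ Q) (hne : Q.Nonempty) (f : ι → E →ₗ[ℝ] ℝ) (a : ι → ℝ) (J : Finset ι)
    (hle : ∀ i ∈ J, ∀ y ∈ Q, a i ≤ f i y) (hlt : ∀ i ∈ J, ∃ y ∈ Q, a i < f i y) :
    ∃ y ∈ Q, ∀ i ∈ J, a i < f i y := by
  induction J using Finset.induction_on with
  | empty => exact ⟨hne.some, hne.some_mem, by simp⟩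
  | insert j J hj ih =>
    obtain ⟨y, hy, hyJ⟩ := ih (fun i hi => hle i (Finset.mem_insert_of_mem hi))
      (fun i hi => hlt i (Finset.mem_insert_of_mem hi))
    obtain ⟨z, hz, hzj⟩ := hlt j (Finset.mem_insert_self j J)
    refine ⟨(1 / 2 : ℝ) • y + (1 / 2 : ℝ) • z,
      hQ hy hz (by norm_num) (by norm_num) (by norm_num), fun i hi => ?_⟩
    have h1 := hle i hi y hy
    have h2 := hle i hi z hz
    simp only [map_add, map_smul, smul_eq_mul]
    rcases Finset.mem_insert.1 hi with rfl | hi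
    · linarith
    · linarith [hyJ i hi]

section FacetRep

variable {P : Set (Euc n)} {u : Set (Euc n) → Euc n} {a : Set (Euc n) → ℝ}
  {I : Finset (Set (Euc n))}

/-- The linear functionals given by pairing with the vectors `u F`. -/
abbrev pairing (u : Set (Euc n) → Euc n) (F : Set (Euc n)) : Euc n →ₗ[ℝ] ℝ := innerₛₗ ℝ (u F)

lemma pairing_apply (u : Set (Euc n) → Euc n) (F : Set (Euc n)) (y : Euc n) :
    pairing u F y = ⟪y, u F⟫ := by
  simp [real_inner_comm]

lemma IsPolyFace.subset {Q : Set (Euc n)} (hQ : IsPolyFace P Q) : Q ⊆ P := by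
  rcases hQ with rfl | ⟨v, -, r, -, rfl⟩
  exacts [Subset.rfl, fun y hy => hy.1]

lemma IsPolyFace.convex (hP : Convex ℝ P) {Q : Set (Euc n)} (hQ : IsPolyFace P Q) :
    Convex ℝ Q := by
  rcases hQ with rfl | ⟨v, -, r, -, rfl⟩
  · exact hP
  · have := hP.inter (convex_hyperplane (innerₛₗ ℝ v).isLinear r)
    convert this using 1
    ext y
    simp [real_inner_comm v y]

/-- Every face has a point at which only the facets containing the face are tight. -/
lemma tightStratum_nonempty_of_isPolyFace (hP : Convex ℝ P)
    (hI : ∀ F ∈ I, (∀ y ∈ P, a F ≤ ⟪y, u F⟫) ∧ F = {y | y ∈ P ∧ ⟪y, u F⟫ = a F})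
    {Q : Set (Euc n)} (hQ : IsPolyFace P Q) (hne : Q.Nonempty) :
    ∃ y ∈ Q, y ∈ tightStratum I (pairing u) a (I.filter fun F => Q ⊆ F) := by
  obtain ⟨y, hy, h⟩ := exists_mem_forall_lt (hQ.convex hP) hne (pairing u) a
    (I.filter fun F => ¬ Q ⊆ F)
    (fun F hF y hy => by
      rw [pairing_apply]
      exact (hI F (Finset.mem_filter.1 hF).1).1 y (hQ.subset hy))
    (fun F hF => by
      obtain ⟨hFI, hFQ⟩ := Finset.mem_filter.1 hF
      obtain ⟨y, hy, hyF⟩ := not_subset.1 hFQ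
      refine ⟨y, hy, ?_⟩
      rw [pairing_apply]
      refine lt_of_le_of_ne ((hI F hFI).1 y (hQ.subset hy)) fun h => hyF ?_
      rw [(hI F hFI).2]
      exact ⟨hQ.subset hy, h.symm⟩)
  refine ⟨y, hy, fun F hF => ?_, fun F hF hFT => ?_⟩
  · obtain ⟨hFI, hFQ⟩ := Finset.mem_filter.1 hF
    have hyF := hFQ hy
    rw [(hI F hFI).2] at hyF
    rw [pairing_apply]
    exact hyF.2
  · exact h F (Finset.mem_filter.2 ⟨hF, fun hs => hFT (Finset.mem_filter.2 ⟨hF, hs⟩)⟩)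

lemma mem_face_of_tight (hrep : P = {y | ∀ F ∈ I, a F ≤ ⟪y, u F⟫}) {Q : Set (Euc n)}
    (hQ : IsPolyFace P Q) {T : Finset (Set (Euc n))} {y : Euc n} (hyQ : y ∈ Q)
    (hy : y ∈ tightStratum I (pairing u) a T) {z : Euc n} (hz : z ∈ P)
    (hzT : ∀ F ∈ T, ⟪z, u F⟫ = a F) : z ∈ Q := by
  rcases hQ with rfl | ⟨v, -, r, hr, rfl⟩
  · exact hz
  refine ⟨hz, le_antisymm (hr z hz) ?_⟩
  have hker : y - z ∈ commonKer (pairing u) T := mem_commonKer.2 fun F hF => by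
    rw [map_sub, hy.1 F hF, pairing_apply, hzT F hF, sub_self]
  obtain ⟨δ, hδ, hm⟩ := isRelOpenConvex_tightStratum.exists_add_smul_mem y hy _ hker
  have hmP : y + δ • (y - z) ∈ P := by
    rw [hrep]
    intro F hF
    rw [← pairing_apply]
    by_cases hFT : F ∈ T
    · exact (hm.1 F hFT).ge
    · exact (hm.2 F hF hFT).le
  have h1 := hr _ hmP
  have h2 := hyQ.2
  simp only [inner_add_left, inner_smul_left, inner_sub_left, h2] at h1
  simp only [RCLike.conj_to_real] at h1
  nlinarith

lemma polyDim_eq_finrank_commonKer {Q : Set (Euc n)} {T : Finset (Set (Euc n))}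
    (hQT : ∀ y ∈ Q, ∀ F ∈ T, ⟪y, u F⟫ = a F) (hsub : tightStratum I (pairing u) a T ⊆ Q)
    (hne : (tightStratum I (pairing u) a T).Nonempty) :
    polyDim Q = Module.finrank ℝ (commonKer (pairing u) T) := by
  rw [polyDim, direction_affineSpan]
  suffices h : vectorSpan ℝ Q = commonKer (pairing u) T by rw [h]
  refine le_antisymm ?_ fun v hv => ?_
  · rw [vectorSpan_def, Submodule.span_le]
    rintro _ ⟨y, hy, z, hz, rfl⟩
    exact mem_commonKer.2 fun F hF => by
      simp only [vsub_eq_sub]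
      rw [map_sub, pairing_apply, pairing_apply, hQT y hy F hF, hQT z hz F hF, sub_self]
  · obtain ⟨y, hy⟩ := hne
    obtain ⟨δ, hδ, hm⟩ := isRelOpenConvex_tightStratum.exists_add_smul_mem y hy v hv
    have := vsub_mem_vectorSpan ℝ (hsub hm) (hsub hy)
    rw [vsub_eq_sub, add_sub_cancel_left] at this
    simpa [smul_smul, hδ.ne'] using (vectorSpan ℝ Q).smul_mem δ⁻¹ this

/-- The points of `P` at which all constraints of `T` are tight form a face, if there are any. -/
lemma isPolyFace_tight (hfull : affineSpan ℝ P = ⊤) (hI : ∀ F ∈ I, ∀ y ∈ P, a F ≤ ⟪y, u F⟫)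
    (hI0 : ∀ F ∈ I, u F ≠ 0) {T : Finset (Set (Euc n))} (hT : T ⊆ I)
    (hne : {y ∈ P | ∀ F ∈ T, ⟪y, u F⟫ = a F}.Nonempty) :
    IsPolyFace P {y ∈ P | ∀ F ∈ T, ⟪y, u F⟫ = a F} := by
  rcases T.eq_empty_or_nonempty with rfl | ⟨F₀, hF₀⟩
  · left; simp
  have hsum : ∀ y, ⟪y, -∑ F ∈ T, u F⟫ = -∑ F ∈ T, ⟪y, u F⟫ := fun y => by
    rw [inner_neg_right, inner_sum]
  have htight : ∀ y ∈ P, (∑ F ∈ T, ⟪y, u F⟫ = ∑ F ∈ T, a F ↔ ∀ F ∈ T, ⟪y, u F⟫ = a F) := by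
    intro y hy
    rw [eq_comm, Finset.sum_eq_sum_iff_of_le fun F hF => hI F (hT hF) y hy]
    simp only [eq_comm]
  refine Or.inr ⟨-∑ F ∈ T, u F, ?_, -∑ F ∈ T, a F, fun y hy => ?_, ?_⟩
  · intro h0
    obtain ⟨z, hz, hzT⟩ := hne
    have hzero : ∀ y, ∑ F ∈ T, ⟪y, u F⟫ = 0 := fun y => by
      rw [← neg_eq_zero, ← hsum, h0, inner_zero_right]
    refine not_subset_hyperplane hfull (hI0 F₀ (hT hF₀)) (a F₀) fun y hy =>
      (htight y hy).1 ?_ F₀ hF₀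
    rw [hzero, ← hzero z, (htight z hz).2 hzT]
  · rw [hsum, neg_le_neg_iff]
    exact Finset.sum_le_sum fun F hF => hI F (hT hF) y hy
  · ext y
    simp only [mem_ofPred_eq, hsum, neg_inj]
    exact and_congr_right fun hy => (htight y hy).symm

end FacetRep

/-- **Brianchon–Gram theorem, outward form.** For a full-dimensional polytope `P ⊂ ℝⁿ` with
facet representation `P = {y : ⟪y, u_F⟫ ≥ a_F for all facets F}` (unit inward normals `u_F`),
`𝟙_P = Σ_{Q ⪯ P} (−1)^{n − dim Q} 𝟙_{T⁻_{P,Q}}`, the sum over the nonempty faces of `P`. -/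
theorem brianchon_gram_outward {n : ℕ} (P : Set (Euc n)) (hP : IsPolytope P)
    (hfull : affineSpan ℝ P = ⊤)
    (u : Set (Euc n) → Euc n) (a : Set (Euc n) → ℝ)
    (hu : ∀ F, IsFacet P F → ‖u F‖ = 1 ∧ (∀ y ∈ P, a F ≤ ⟪y, u F⟫) ∧
        F = {y | y ∈ P ∧ ⟪y, u F⟫ = a F})
    (hrep : P = {y | ∀ F, IsFacet P F → a F ≤ ⟪y, u F⟫})
    (hfin : {Q | IsPolyFace P Q ∧ Q.Nonempty}.Finite) :
    ∀ x : Euc n,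
      P.indicator (fun _ => (1 : ℝ)) x =
        ∑ Q ∈ hfin.toFinset, (-1 : ℝ) ^ (n - polyDim Q) *
          (outwardTC P u a Q).indicator (fun _ => (1 : ℝ)) x := by
  intro x
  have hIfin : {F | IsFacet P F}.Finite := by
    refine (hfin.insert ∅).subset fun F hF => ?_
    rcases F.eq_empty_or_nonempty with h | h
    exacts [Or.inl h, Or.inr ⟨hF.1, h⟩]
  set I := hIfin.toFinset with hI
  have hmemI : ∀ F, F ∈ I ↔ IsFacet P F := fun F => by simp [hI]
  have hrepI : P = {y | ∀ F ∈ I, a F ≤ ⟪y, u F⟫} := by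
    simp only [hmemI]
    exact hrep
  have huI : ∀ F ∈ I, (∀ y ∈ P, a F ≤ ⟪y, u F⟫) ∧ F = {y | y ∈ P ∧ ⟪y, u F⟫ = a F} :=
    fun F hF => (hu F ((hmemI F).1 hF)).2
  have hu0 : ∀ F ∈ I, u F ≠ 0 := fun F hF h => by
    have := (hu F ((hmemI F).1 hF)).1
    simp [h] at this
  have hconv : Convex ℝ P := by
    obtain ⟨S, rfl⟩ := hP
    exact convex_convexHull ℝ _
  have hPne : P.Nonempty := by
    rw [← affineSpan_nonempty ℝ, hfull]
    exact ⟨0, trivial⟩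
  have hstratum_sub : ∀ T, tightStratum I (pairing u) a T ⊆
      {y ∈ P | ∀ F ∈ T, ⟪y, u F⟫ = a F} := by
    intro T y hy
    have hyT : ∀ F ∈ T, ⟪y, u F⟫ = a F := fun F hF => by
      rw [← pairing_apply]
      exact hy.1 F hF
    refine ⟨?_, hyT⟩
    rw [hrepI]
    intro F hF
    by_cases hFT : F ∈ T
    · exact (hyT F hFT).ge
    · rw [← pairing_apply]
      exact (hy.2 F hF hFT).le
  have hfacets : ∀ {T : Finset (Set (Euc n))}, T ⊆ I →
      (tightStratum I (pairing u) a T).Nonempty →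
      I.filter (fun F => {y ∈ P | ∀ F ∈ T, ⟪y, u F⟫ = a F} ⊆ F) = T := by
    rintro T hT ⟨y, hy⟩
    ext F
    rw [Finset.mem_filter]
    refine ⟨fun ⟨hF, hsub⟩ => ?_, fun hF => ⟨hT hF, fun z hz => ?_⟩⟩
    · by_contra hFT
      have hyF := hsub (hstratum_sub T hy)
      rw [(huI F hF).2] at hyF
      have hlt := hy.2 F hF hFT
      rw [pairing_apply] at hlt
      exact hlt.ne' hyF.2
    · rw [(huI F (hT hF)).2]
      exact ⟨hz.1, hz.2 F hF⟩
  have hface : ∀ Q, IsPolyFace P Q → Q.Nonempty →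
      (tightStratum I (pairing u) a (I.filter fun F => Q ⊆ F)).Nonempty ∧
      Q = {y ∈ P | ∀ F ∈ I.filter (fun F => Q ⊆ F), ⟪y, u F⟫ = a F} := by
    intro Q hQ hne
    obtain ⟨y, hyQ, hy⟩ := tightStratum_nonempty_of_isPolyFace hconv huI hQ hne
    refine ⟨⟨y, hy⟩, Subset.antisymm (fun z hz => ⟨hQ.subset hz, fun F hF => ?_⟩)
      fun z hz => mem_face_of_tight hrepI hQ hyQ hy hz.1 hz.2⟩
    obtain ⟨hFI, hFQ⟩ := Finset.mem_filter.1 hF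
    have hzF := hFQ hz
    rw [(huI F hFI).2] at hzF
    exact hzF.2
  have hdim : ∀ Q, IsPolyFace P Q → Q.Nonempty →
      polyDim Q = Module.finrank ℝ (commonKer (pairing u) (I.filter fun F => Q ⊆ F)) := by
    intro Q hQ hne
    obtain ⟨h1, h2⟩ := hface Q hQ hne
    refine polyDim_eq_finrank_commonKer (fun y hy => ?_) (fun y hy => ?_) h1
    · rw [h2] at hy
      exact hy.2
    · rw [h2]
      exact hstratum_sub _ hy
  have hvisible : ∀ Q, x ∈ outwardTC P u a Q ↔
      ∀ F ∈ I.filter (fun F => Q ⊆ F), pairing u F x < a F := by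
    intro Q
    simp only [Finset.mem_filter, hmemI, pairing_apply, and_imp]
    rfl
  have hint : (tightStratum I (pairing u) a ∅).Nonempty := by
    have h0 : I.filter (fun F => P ⊆ F) = ∅ := by
      refine Finset.filter_eq_empty_iff.2 fun F hF hPF => ?_
      refine not_subset_hyperplane hfull (hu0 F hF) (a F) fun y hy => ?_
      have hyF := hPF hy
      rw [(huI F hF).2] at hyF
      exact hyF.2
    rw [← h0]
    exact (hface P (Or.inl rfl) hPne).1
  have hPx : x ∉ P ↔ ∃ F ∈ I, pairing u F x < a F := by
    rw [hrepI]
    simp only [mem_ofPred_eq, pairing_apply, not_forall, not_le, exists_prop]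
  have hle : ∀ Q : Set (Euc n), polyDim Q ≤ n := fun Q =>
    (Submodule.finrank_le _).trans finrank_euclideanSpace_fin.le
  have hsign : ∀ Q : Set (Euc n), (-1 : ℝ) ^ (n - polyDim Q) = (-1) ^ n * (-1) ^ polyDim Q := by
    intro Q
    have h1 : (-1 : ℝ) ^ n = (-1) ^ (n - polyDim Q) * (-1) ^ polyDim Q := by
      rw [← pow_add, Nat.sub_add_cancel (hle Q)]
    have h2 : (-1 : ℝ) ^ polyDim Q * (-1) ^ polyDim Q = 1 := by
      rw [← mul_pow]
      simp
    rw [h1, mul_assoc, h2, mul_one]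
  calc P.indicator (fun _ => (1 : ℝ)) x
      = (-1) ^ n * (if ∃ F ∈ I, pairing u F x < a F then 0 else
          (-1) ^ Module.finrank ℝ (Euc n)) := by
        by_cases hx : x ∈ P
        · rw [if_neg (fun h => hPx.2 h hx), indicator_of_mem hx, finrank_euclideanSpace_fin,
            ← mul_pow]
          simp
        · rw [if_pos (hPx.1 hx), indicator_of_notMem hx, mul_zero]
    _ = (-1) ^ n * ∑ Q ∈ hfin.toFinset.filter (fun Q => x ∈ outwardTC P u a Q),
          (-1 : ℝ) ^ polyDim Q := by
        rw [← sum_visible_strata hint x]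
        congr 1
        symm
        refine Finset.sum_bij (fun Q _ => I.filter fun F => Q ⊆ F) ?_ ?_ ?_ ?_
        · intro Q hQ
          obtain ⟨hQ, hxQ⟩ := Finset.mem_filter.1 hQ
          obtain ⟨hQ, hne⟩ := hfin.mem_toFinset.1 hQ
          exact Finset.mem_filter.2 ⟨Finset.mem_powerset.2 (Finset.filter_subset _ _),
            (hface Q hQ hne).1, (hvisible Q).1 hxQ⟩
        · intro Q hQ Q' hQ' h
          obtain ⟨hQ, hne⟩ := hfin.mem_toFinset.1 (Finset.mem_filter.1 hQ).1
          obtain ⟨hQ', hne'⟩ := hfin.mem_toFinset.1 (Finset.mem_filter.1 hQ').1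
          rw [(hface Q hQ hne).2, (hface Q' hQ' hne').2, h]
        · intro T hT
          obtain ⟨hTI, hne, hxT⟩ := Finset.mem_filter.1 hT
          have hTI := Finset.mem_powerset.1 hTI
          have hQne := hne.mono (hstratum_sub T)
          refine ⟨_, Finset.mem_filter.2 ⟨hfin.mem_toFinset.2
            ⟨isPolyFace_tight hfull (fun F hF => (huI F hF).1) hu0 hTI hQne, hQne⟩, ?_⟩,
            hfacets hTI hne⟩
          rw [hvisible, hfacets hTI hne]
          exact hxT
        · intro Q hQ
          obtain ⟨hQ, hne⟩ := hfin.mem_toFinset.1 (Finset.mem_filter.1 hQ).1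
          rw [hdim Q hQ hne]
    _ = _ := by
        rw [Finset.sum_filter, Finset.mul_sum]
        refine Finset.sum_congr rfl fun Q _ => ?_
        rw [hsign, mul_assoc, indicator_apply]
        split_ifs <;> simp
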